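/- Let p be an integer, let ℓ be a nonnegative integer, and let c be a real number. If p + ℓ is even, then ∫_0^π J_p(c·cos τ) · cos(ℓτ) dτ = π · J_{(p+ℓ)/2}(c/2) · J_{(p−ℓ)/2}(c/2); if p + ℓ is odd, then ∫_0^π J_p(c·cos τ) · cos(ℓτ) dτ = 0. -/

import Mathlib

/-- The Bessel function of the first kind of nonnegative integer order `n`,
defined by its everywhere-convergent power series. -/
noncomputable def besselJNat (n : ℕ) (x : ℝ) : ℝ :=
  ∑' q : ℕ, (-1 : ℝ) ^ q * (x / 2) ^ (2 * q + n) /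
    ((q.factorial : ℝ) * ((q + n).factorial : ℝ))

/-- The Bessel function of the first kind of integer order. -/
noncomputable def besselJ (n : ℤ) (x : ℝ) : ℝ :=
  if 0 ≤ n then besselJNat n.toNat x else (-1 : ℝ) ^ n * besselJNat (-n).toNat x

lemma choose_fact (i j : ℕ) :
    (i + j).choose i * i.factorial * j.factorial = (i + j).factorial := by
  have := Nat.choose_mul_factorial_mul_factorial (Nat.le_add_right i j)
  simpa using this

lemma bj_summable (n : ℕ) (x : ℝ) : Summable (fun q : ℕ => (-1 : ℝ) ^ q * (x / 2) ^ (2 * q + n) /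
    ((q.factorial : ℝ) * ((q + n).factorial : ℝ))) := by
  have h := (Real.summable_pow_div_factorial ((x/2)^2)).mul_left (|x/2|^n)
  refine Summable.of_norm_bounded h (fun q => ?_)
  rw [Real.norm_eq_abs, abs_div, abs_mul, abs_pow, abs_neg, abs_one, one_pow, one_mul, abs_pow,
    abs_of_pos (by positivity : (0:ℝ) < (q.factorial : ℝ) * ((q + n).factorial : ℝ)),
    pow_add, pow_mul, sq_abs, mul_comm, mul_div_assoc]
  have h1 : (1:ℝ) ≤ ((q + n).factorial : ℝ) := by exact_mod_cast Nat.succ_le_of_lt (Nat.factorial_pos _)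
  have h2 : (0:ℝ) < (q.factorial : ℝ) := by positivity
  gcongr
  nlinarith

lemma cos_int (n : ℕ) : ∀ k : ℕ, ∫ τ in (0:ℝ)..Real.pi,
    Real.cos τ ^ n * Real.cos ((2 * k - n) * τ) = Real.pi / 2 ^ n * (n.choose k : ℝ) := by
  induction n with
  | zero =>
    intro k
    rcases Nat.eq_zero_or_pos k with rfl | hk
    · simp
    · have hk0 : (k:ℝ) ≠ 0 := by positivity
      rw [Nat.choose_eq_zero_of_lt hk]
      simp only [pow_zero, one_mul, Nat.cast_zero, sub_zero, mul_zero]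
      rw [intervalIntegral.integral_comp_mul_left (fun t => Real.cos t) (by positivity)]
      have : Real.sin (2 * k * Real.pi) = 0 := by
        have := Real.sin_nat_mul_pi (2 * k)
        push_cast at this
        exact this
      simp [this]
  | succ n ih =>
    have key : ∀ a : ℝ, ∫ τ in (0:ℝ)..Real.pi, Real.cos τ ^ (n+1) * Real.cos (a * τ) =
        ((∫ τ in (0:ℝ)..Real.pi, Real.cos τ ^ n * Real.cos ((a+1) * τ)) +
          ∫ τ in (0:ℝ)..Real.pi, Real.cos τ ^ n * Real.cos ((a-1) * τ)) / 2 := by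
      intro a
      rw [← intervalIntegral.integral_add, ← intervalIntegral.integral_div]
      · congr 1
        ext τ
        rw [add_mul, sub_mul, one_mul, Real.cos_add, Real.cos_sub]
        ring
      · exact (by fun_prop : Continuous _).intervalIntegrable _ _
      · exact (by fun_prop : Continuous _).intervalIntegrable _ _
    intro k
    rw [key]
    cases k with
    | zero =>
      have h1 := ih 0
      have h2 := ih (n+1)
      have e1 : ∀ τ : ℝ, Real.cos ((2 * ((0:ℕ):ℝ) - ((n+1:ℕ):ℝ) + 1) * τ) =
          Real.cos ((2 * ((0:ℕ):ℝ) - (n:ℝ)) * τ) := by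
        intro τ; congr 1; push_cast; ring
      have e2 : ∀ τ : ℝ, Real.cos ((2 * ((0:ℕ):ℝ) - ((n+1:ℕ):ℝ) - 1) * τ) =
          Real.cos ((2 * ((n+1:ℕ):ℝ) - (n:ℝ)) * τ) := by
        intro τ; rw [← Real.cos_neg]; congr 1; push_cast; ring
      simp only [e1, e2]
      rw [h1, h2]
      simp
      ring
    | succ k =>
      have h1 := ih (k+1)
      have h2 := ih k
      have e1 : ∀ τ : ℝ, Real.cos ((2 * ((k+1:ℕ):ℝ) - ((n+1:ℕ):ℝ) + 1) * τ) =
          Real.cos ((2 * ((k+1:ℕ):ℝ) - (n:ℝ)) * τ) := by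
        intro τ; congr 1; push_cast; ring
      have e2 : ∀ τ : ℝ, Real.cos ((2 * ((k+1:ℕ):ℝ) - ((n+1:ℕ):ℝ) - 1) * τ) =
          Real.cos ((2 * ((k:ℕ):ℝ) - (n:ℝ)) * τ) := by
        intro τ; congr 1; push_cast; ring
      simp only [e1, e2]
      rw [h1, h2, Nat.choose_succ_succ]
      push_cast
      ring

lemma vand (m s r : ℕ) : ∑ ij ∈ Finset.HasAntidiagonal.antidiagonal r,
    (1:ℝ) / ((ij.1.factorial : ℝ) * ((ij.1 + m).factorial : ℝ)) *
      (1 / ((ij.2.factorial : ℝ) * ((ij.2 + s).factorial : ℝ))) =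
    ((2 * r + m + s).factorial : ℝ) / ((r.factorial : ℝ) * ((r+m+s).factorial : ℝ) *
      ((r+m).factorial : ℝ) * ((r+s).factorial : ℝ)) := by
  have h := Nat.add_choose_eq (r+s) (r+m) r
  have h3 := choose_fact r (r+m+s)
  rw [show r + (r+m+s) = 2*r+m+s by ring] at h3
  rw [show r+s+(r+m) = 2*r+m+s by ring] at h
  have h3' : ((2*r+m+s).choose r : ℝ) * r.factorial * (r+m+s).factorial = (2*r+m+s).factorial := by
    exact_mod_cast h3
  have h' : ((2*r+m+s).choose r : ℝ) = ∑ ij ∈ Finset.HasAntidiagonal.antidiagonal r,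
      ((r+s).choose ij.1 : ℝ) * ((r+m).choose ij.2 : ℝ) := by exact_mod_cast h
  rw [← h3', h']
  rw [eq_div_iff (by positivity), Finset.sum_mul, Finset.sum_mul, Finset.sum_mul]
  refine Finset.sum_congr rfl ?_
  rintro ⟨i, j⟩ hij
  rw [Finset.HasAntidiagonal.mem_antidiagonal] at hij
  simp only at hij ⊢
  subst hij
  have a1 := choose_fact i (j+s)
  have a2 := choose_fact j (i+m)
  rw [show i+(j+s) = i+j+s by ring] at a1
  rw [show j+(i+m) = i+j+m by ring] at a2
  have a1' : ((i+j+s).choose i : ℝ) * i.factorial * (j+s).factorial = (i+j+s).factorial := by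
    exact_mod_cast a1
  have a2' : ((i+j+m).choose j : ℝ) * j.factorial * (i+m).factorial = (i+j+m).factorial := by
    exact_mod_cast a2
  rw [← a1', ← a2']
  field_simp

lemma bj_mul (m s : ℕ) (x : ℝ) : besselJNat m x * besselJNat s x =
    ∑' r : ℕ, (-1 : ℝ) ^ r * (x / 2) ^ (2 * r + m + s) *
     (((2 * r + m + s).factorial : ℝ) / ((r.factorial : ℝ) * ((r+m+s).factorial : ℝ) *
      ((r+m).factorial : ℝ) * ((r+s).factorial : ℝ))) := by
  unfold besselJNat
  rw [tsum_mul_tsum_eq_tsum_sum_antidiagonal_of_summable_norm (bj_summable m x).norm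
    (bj_summable s x).norm]
  refine tsum_congr fun r => ?_
  rw [← vand, Finset.mul_sum]
  refine Finset.sum_congr rfl ?_
  rintro ⟨i, j⟩ hij
  rw [Finset.HasAntidiagonal.mem_antidiagonal] at hij
  simp only at hij ⊢
  subst hij
  ring

lemma bj_int (p m ℓ : ℕ) (c : ℝ) (h : p + ℓ = 2 * m) :
    HasSum (fun q : ℕ => Real.pi * ((-1 : ℝ) ^ q * (c / 4) ^ (2 * q + p) *
      (((2*q+p).choose (q+m) : ℝ) / ((q.factorial : ℝ) * ((q + p).factorial : ℝ)))))
    (∫ τ in (0 : ℝ)..Real.pi, besselJNat p (c * Real.cos τ) * Real.cos (ℓ * τ)) := by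
  have H := intervalIntegral.hasSum_integral_of_dominated_convergence (μ := MeasureTheory.volume)
    (a := 0) (b := Real.pi)
    (F := fun (q : ℕ) (τ : ℝ) => ((-1 : ℝ) ^ q * (c * Real.cos τ / 2) ^ (2 * q + p) /
    ((q.factorial : ℝ) * ((q + p).factorial : ℝ))) * Real.cos (ℓ * τ))
    (f := fun τ => besselJNat p (c * Real.cos τ) * Real.cos (ℓ * τ))
    (fun q _ => ‖(-1 : ℝ) ^ q * (c / 2) ^ (2 * q + p) /
    ((q.factorial : ℝ) * ((q + p).factorial : ℝ))‖) ?_ ?_ ?_ ?_ ?_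
  · refine (congrArg (fun f : ℕ → ℝ => HasSum f _) (funext fun q => ?_)).mpr H
    have hc := cos_int (2*q+p) (q+m)
    have e : ∀ τ : ℝ, Real.cos ((2 * ((q+m:ℕ):ℝ) - ((2*q+p:ℕ):ℝ)) * τ) = Real.cos (ℓ * τ) := by
      intro τ
      congr 2
      have : (p:ℝ) + ℓ = 2 * m := by exact_mod_cast h
      push_cast
      linarith
    simp only [e] at hc
    have e2 : ∀ τ : ℝ, ((-1 : ℝ) ^ q * (c * Real.cos τ / 2) ^ (2 * q + p) /
      ((q.factorial : ℝ) * ((q + p).factorial : ℝ))) * Real.cos (ℓ * τ) =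
      ((-1 : ℝ) ^ q * (c / 2) ^ (2 * q + p) /
      ((q.factorial : ℝ) * ((q + p).factorial : ℝ))) *
        (Real.cos τ ^ (2*q+p) * Real.cos (ℓ * τ)) := by
      intro τ
      rw [show c * Real.cos τ / 2 = c / 2 * Real.cos τ by ring, mul_pow]
      ring
    simp only [e2]
    rw [intervalIntegral.integral_const_mul, hc, show c / 4 = c / 2 / 2 by ring, div_pow (c/2) 2]
    ring
  · intro q
    exact (by fun_prop : Continuous _).aestronglyMeasurable
  · intro q
    refine Filter.Eventually.of_forall fun τ _ => ?_
    rw [norm_mul, norm_div, norm_div, norm_mul, norm_mul ((-1 : ℝ) ^ q) ((c / 2) ^ (2 * q + p)),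
      norm_mul, norm_pow (c * Real.cos τ / 2),
      norm_pow (c/2)]
    have h1 : ‖Real.cos (ℓ * τ)‖ ≤ 1 := Real.abs_cos_le_one _
    have h2 : ‖c * Real.cos τ / 2‖ ≤ ‖c / 2‖ := by
      rw [show c * Real.cos τ / 2 = c / 2 * Real.cos τ by ring, norm_mul]
      exact mul_le_of_le_one_right (norm_nonneg _) (Real.abs_cos_le_one _)
    refine (mul_le_of_le_one_right (by positivity) h1).trans ?_
    gcongr
  · exact Filter.Eventually.of_forall fun τ _ => (bj_summable p c).norm
  · exact intervalIntegrable_const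
  · exact Filter.Eventually.of_forall fun τ _ => (bj_summable p _).hasSum.mul_right _

lemma bj_zneg (n : ℤ) (x : ℝ) : besselJ (-n) x = (-1 : ℝ) ^ n * besselJ n x := by
  unfold besselJ
  have hs : (-1 : ℝ) ^ n * (-1 : ℝ) ^ n = 1 := by
    rw [← mul_zpow]; simp
  rcases lt_trichotomy n 0 with h | rfl | h
  · rw [if_pos (by omega), if_neg (by omega), ← mul_assoc, hs, one_mul]
  · simp
  · rw [if_neg (by omega), if_pos (by omega), neg_neg, zpow_neg, ← inv_zpow]
    norm_num

lemma bj_nat (n : ℕ) (x : ℝ) : besselJ (n : ℤ) x = besselJNat n x := by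
  simp [besselJ]

lemma bj_odd (n : ℕ) (x : ℝ) : besselJNat n (-x) = (-1 : ℝ) ^ n * besselJNat n x := by
  unfold besselJNat
  rw [← tsum_mul_left]
  refine tsum_congr fun q => ?_
  rw [show -x / 2 = (-1) * (x / 2) by ring, mul_pow (-1 : ℝ), pow_add (-1 : ℝ), pow_mul (-1 : ℝ)]
  norm_num
  ring

lemma even_nat (p ℓ : ℕ) (c : ℝ) (h : Even ((p : ℤ) + (ℓ : ℤ))) :
    ∫ τ in (0 : ℝ)..Real.pi, besselJ p (c * Real.cos τ) * Real.cos (ℓ * τ) =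
      Real.pi * besselJ (((p:ℤ) + (ℓ : ℤ)) / 2) (c / 2) *
        besselJ (((p:ℤ) - (ℓ : ℤ)) / 2) (c / 2) := by
  have h0 : ∃ m : ℕ, p + ℓ = 2 * m := by
    obtain ⟨k, hk⟩ := h
    exact ⟨k.toNat, by omega⟩
  obtain ⟨m, hm⟩ := h0
  have H := bj_int p m ℓ c hm
  simp only [bj_nat]
  rw [show ((p:ℤ) + (ℓ : ℤ)) / 2 = (m : ℤ) by omega, bj_nat, mul_assoc, ← H.tsum_eq]
  rcases le_total m p with hmp | hmp
  · obtain ⟨s, rfl⟩ := Nat.exists_eq_add_of_le hmp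
    rw [show (((m + s : ℕ):ℤ) - (ℓ : ℤ)) / 2 = (s : ℤ) by omega, bj_nat, bj_mul, ← tsum_mul_left]
    refine tsum_congr fun q => ?_
    have a := choose_fact (q+m) (q+s)
    rw [show q + m + (q+s) = 2*q+m+s by ring] at a
    have a' : ((2*q+m+s).choose (q+m) : ℝ) * (q+m).factorial * (q+s).factorial =
      (2*q+m+s).factorial := by exact_mod_cast a
    rw [← a', show c / 2 / 2 = c / 4 by ring, ← add_assoc, ← add_assoc]
    congr 2
    field_simp
  · obtain ⟨s, rfl⟩ := Nat.exists_eq_add_of_le hmp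
    rw [show ((p:ℤ) - (ℓ : ℤ)) / 2 = -(s : ℤ) by omega, bj_zneg, bj_nat, mul_left_comm (besselJNat (p + s) (c / 2)),
      bj_mul, ← H.summable.sum_add_tsum_nat_add s, Finset.sum_eq_zero, zero_add, ← tsum_mul_left,
      ← tsum_mul_left]
    · refine tsum_congr fun r => ?_
      have a := choose_fact (r+s+(p+s)) r
      have a' : ((2*(r+s)+p).choose (r+s+(p+s)) : ℝ) * (r+s+(p+s)).factorial * r.factorial =
        (2*(r+s)+p).factorial := by
        rw [show r+s+(p+s) + r = 2*(r+s)+p by ring] at a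
        exact_mod_cast a
      rw [show 2*r+(p+s)+s = 2*(r+s)+p by ring, ← a', show c / 2 / 2 = c / 4 by ring,
        show r+(p+s)+s = r+s+(p+s) by ring, show r+(p+s) = r+s+p by ring, zpow_natCast, pow_add]
      field_simp
    · intro q hq
      rw [Finset.mem_range] at hq
      rw [Nat.choose_eq_zero_of_lt (by omega)]
      simp

lemma odd_nat (p ℓ : ℕ) (c : ℝ) (h : Odd ((p : ℤ) + (ℓ : ℤ))) :
    ∫ τ in (0 : ℝ)..Real.pi, besselJ p (c * Real.cos τ) * Real.cos (ℓ * τ) = 0 := by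
  have h' : Odd (p + ℓ) := by exact_mod_cast h
  have H := intervalIntegral.integral_comp_sub_left (a := 0) (b := Real.pi)
    (fun τ => besselJ p (c * Real.cos τ) * Real.cos (ℓ * τ)) Real.pi
  have e : ∀ τ : ℝ, besselJ p (c * Real.cos (Real.pi - τ)) * Real.cos (ℓ * (Real.pi - τ)) =
      -(besselJ p (c * Real.cos τ) * Real.cos (ℓ * τ)) := by
    intro τ
    rw [Real.cos_pi_sub, mul_neg, bj_nat, bj_nat, bj_odd, mul_sub, Real.cos_nat_mul_pi_sub]
    have : (-1:ℝ)^p * (-1:ℝ)^ℓ = -1 := by rw [← pow_add, h'.neg_one_pow]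
    linear_combination (besselJNat p (c * Real.cos τ) * Real.cos (ℓ * τ)) * this
  simp only [e, intervalIntegral.integral_neg, sub_self, sub_zero] at H
  linarith

theorem stmt9 (p : ℤ) (ℓ : ℕ) (c : ℝ) :
    (Even (p + (ℓ : ℤ)) →
      ∫ τ in (0 : ℝ)..Real.pi, besselJ p (c * Real.cos τ) * Real.cos (ℓ * τ) =
        Real.pi * besselJ ((p + (ℓ : ℤ)) / 2) (c / 2) * besselJ ((p - (ℓ : ℤ)) / 2) (c / 2)) ∧
    (Odd (p + (ℓ : ℤ)) →
      ∫ τ in (0 : ℝ)..Real.pi, besselJ p (c * Real.cos τ) * Real.cos (ℓ * τ) = 0) := by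
  obtain ⟨n, rfl | rfl⟩ := p.eq_nat_or_neg
  · exact ⟨even_nat n ℓ c, odd_nat n ℓ c⟩
  · simp only [bj_zneg, mul_assoc, intervalIntegral.integral_const_mul]
    constructor
    · intro h
      have h1 : Even ((n:ℤ) + ℓ) := by rw [Int.even_iff] at *; omega
      rw [even_nat n ℓ c h1]
      obtain ⟨k, hk⟩ := h1
      have e1 : (-(n:ℤ) + ℓ) / 2 = -(((n:ℤ) - ℓ) / 2) := by omega
      have e2 : (-(n:ℤ) - ℓ) / 2 = -(((n:ℤ) + ℓ) / 2) := by omega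
      rw [e1, e2, bj_zneg, bj_zneg]
      have e3 : (-1:ℝ) ^ (n:ℤ) = (-1:ℝ) ^ (((n:ℤ) - ℓ) / 2) * (-1:ℝ) ^ (((n:ℤ) + ℓ) / 2) := by
        rw [← zpow_add₀ (by norm_num)]
        congr 1
        omega
      rw [e3]
      ring
    · intro h
      have h1 : Odd ((n:ℤ) + ℓ) := by rw [Int.odd_iff] at *; omega
      rw [odd_nat n ℓ c h1, mul_zero]
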